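/- Let V, V' ∈ M_{2g}(ℚ) be invertible Seifert matrices. Let P ∈ M_{2g}(ℚ) be a matrix satisfying P (Vᵗ V^{-1}) = (V'ᵗ V'^{-1}) P and Pᵗ J_{2g} P = J_{2g}. Then P is symplectic (P J_{2g} Pᵗ = J_{2g}) and V' = P V Pᵗ. -/

import Mathlib

open Matrix

/-- The standard symplectic `2g × 2g` matrix with `g` diagonal blocks `[[0,-1],[1,0]]`. -/
def Jmat (R : Type*) [CommRing R] (g : ℕ) : Matrix (Fin (2*g)) (Fin (2*g)) R :=
  Matrix.of fun i j =>
    if i.val % 2 = 0 ∧ j.val = i.val + 1 then (-1 : R)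
    else if j.val % 2 = 0 ∧ i.val = j.val + 1 then 1
    else 0

/-- A Seifert matrix: `V - Vᵀ = J`. -/
def IsSeifert {R : Type*} [CommRing R] {g : ℕ} (V : Matrix (Fin (2*g)) (Fin (2*g)) R) : Prop :=
  V - Vᵀ = Jmat R g

/-- A symplectic matrix: `P * J * Pᵀ = J`. -/
def IsSymplectic {R : Type*} [CommRing R] {g : ℕ} (P : Matrix (Fin (2*g)) (Fin (2*g)) R) : Prop :=
  P * Jmat R g * Pᵀ = Jmat R g

/-- A rational matrix with integer entries. -/
def IsIntegralMat {n : ℕ} (P : Matrix (Fin n) (Fin n) ℚ) : Prop :=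
  ∀ i j, ∃ m : ℤ, P i j = (m : ℚ)

/-- Row enlargement `[[0,0,0],[1,x,ρᵗ],[0,ρ,V]]` of a matrix `V`. -/
def rowEnl {R : Type*} [CommRing R] {g : ℕ} (V : Matrix (Fin (2*g)) (Fin (2*g)) R)
    (x : R) (ρ : Fin (2*g) → R) : Matrix (Fin (2*(g+1))) (Fin (2*(g+1))) R :=
  Matrix.of fun i j =>
    if hi : 2 ≤ i.val then
      if hj : 2 ≤ j.val then V ⟨i.val - 2, by have := i.2; omega⟩ ⟨j.val - 2, by have := j.2; omega⟩
      else if j.val = 1 then ρ ⟨i.val - 2, by have := i.2; omega⟩ else 0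
    else
      if i.val = 0 then 0
      else
        if hj : 2 ≤ j.val then ρ ⟨j.val - 2, by have := j.2; omega⟩
        else if j.val = 0 then 1 else x

/-- Column enlargement `[[0,-1,0],[0,x,ρᵗ],[0,ρ,V]]` of a matrix `V`. -/
def colEnl {R : Type*} [CommRing R] {g : ℕ} (V : Matrix (Fin (2*g)) (Fin (2*g)) R)
    (x : R) (ρ : Fin (2*g) → R) : Matrix (Fin (2*(g+1))) (Fin (2*(g+1))) R :=
  Matrix.of fun i j =>
    if hi : 2 ≤ i.val then
      if hj : 2 ≤ j.val then V ⟨i.val - 2, by have := i.2; omega⟩ ⟨j.val - 2, by have := j.2; omega⟩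
      else if j.val = 1 then ρ ⟨i.val - 2, by have := i.2; omega⟩ else 0
    else
      if i.val = 0 then (if j.val = 1 then -1 else 0)
      else
        if hj : 2 ≤ j.val then ρ ⟨j.val - 2, by have := j.2; omega⟩
        else if j.val = 0 then 0 else x

/-- `W` is an enlargement (row or column) of `V`. -/
def IsEnlargement {R : Type*} [CommRing R] {g : ℕ} (V : Matrix (Fin (2*g)) (Fin (2*g)) R)
    (W : Matrix (Fin (2*(g+1))) (Fin (2*(g+1))) R) : Prop :=
  ∃ (x : R) (ρ : Fin (2*g) → R), W = rowEnl V x ρ ∨ W = colEnl V x ρ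

/-- The diagonal matrix `diag(n, n⁻¹, 1, …, 1)` of size `2g`. -/
def Delta (g : ℕ) (n : ℚ) : Matrix (Fin (2*g)) (Fin (2*g)) ℚ :=
  Matrix.diagonal (fun i => if i.val = 0 then n else if i.val = 1 then n⁻¹ else 1)

theorem Jmat_mul_self (R : Type*) [CommRing R] (g : ℕ) : Jmat R g * Jmat R g = -1 := by
  ext i j
  rw [Matrix.mul_apply, Matrix.neg_apply, Matrix.one_apply]
  obtain ⟨i, hi⟩ := i
  obtain ⟨j, hj⟩ := j
  rcases Nat.mod_two_eq_zero_or_one i with h | h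
  · rw [Finset.sum_eq_single (⟨i + 1, by omega⟩ : Fin (2*g))]
    · simp only [Jmat, Matrix.of_apply, Fin.mk.injEq, and_true]
      split_ifs <;> first | omega | simp
    · rintro ⟨k, hk⟩ - hne
      have hne : k ≠ i + 1 := fun h => hne (Fin.ext h)
      have hzero : Jmat R g ⟨i, hi⟩ ⟨k, hk⟩ = 0 := by
        simp only [Jmat, Matrix.of_apply]
        split_ifs <;> first | omega | rfl
      rw [hzero, zero_mul]
    · simp
  · rw [Finset.sum_eq_single (⟨i - 1, by omega⟩ : Fin (2*g))]
    · simp only [Jmat, Matrix.of_apply, Fin.mk.injEq]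
      split_ifs <;> first | omega | simp
    · rintro ⟨k, hk⟩ - hne
      have hne : k ≠ i - 1 := fun h => hne (Fin.ext h)
      have hzero : Jmat R g ⟨i, hi⟩ ⟨k, hk⟩ = 0 := by
        simp only [Jmat, Matrix.of_apply]
        split_ifs <;> first | omega | rfl
      rw [hzero, zero_mul]
    · simp

theorem isSymplectic_of_transpose_mul_Jmat_mul {R : Type*} [CommRing R] {g : ℕ}
    {P : Matrix (Fin (2*g)) (Fin (2*g)) R} (h : Pᵀ * Jmat R g * P = Jmat R g) :
    IsSymplectic P := by
  have hleft : -(Jmat R g * Pᵀ * Jmat R g) * P = 1 := by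
    rw [neg_mul, mul_assoc, mul_assoc, ← mul_assoc Pᵀ, h, Jmat_mul_self, neg_neg]
  have hright := mul_eq_one_comm.mp hleft
  calc P * Jmat R g * Pᵀ = P * -(Jmat R g * Pᵀ * Jmat R g) * Jmat R g := by
        simp only [mul_neg, neg_mul, mul_assoc, Jmat_mul_self, mul_one, neg_neg]
    _ = Jmat R g := by rw [hright, one_mul]

theorem IsSeifert.transpose_mul_inv {R : Type*} [CommRing R] {g : ℕ}
    {V : Matrix (Fin (2*g)) (Fin (2*g)) R} (hV : IsSeifert V) (hdet : IsUnit V.det) :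
    Vᵀ * V⁻¹ = 1 - Jmat R g * V⁻¹ := by
  rw [← show V - Vᵀ = Jmat R g from hV, sub_mul, Matrix.mul_nonsing_inv V hdet, sub_sub_cancel]

/-- Proposition `propcasinv`: if `V, V'` are invertible Seifert matrices
and `P` intertwines the `t`-actions `VᵀV⁻¹` and `V'ᵀV'⁻¹` and preserves the scalar form
(`Pᵀ J P = J`), then `P` is symplectic and `V' = P V Pᵀ`. -/
theorem symplectic_congruence_of_intertwining {g : ℕ}
    (V V' P : Matrix (Fin (2*g)) (Fin (2*g)) ℚ)
    (hV : IsSeifert V) (hV' : IsSeifert V')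
    (hVinv : IsUnit V.det) (hV'inv : IsUnit V'.det)
    (hcomm : P * (Vᵀ * V⁻¹) = (V'ᵀ * V'⁻¹) * P)
    (hform : Pᵀ * Jmat ℚ g * P = Jmat ℚ g) :
    IsSymplectic P ∧ V' = P * V * Pᵀ := by
  have hP := isSymplectic_of_transpose_mul_Jmat_mul hform
  refine ⟨hP, ?_⟩
  rw [hV.transpose_mul_inv hVinv, hV'.transpose_mul_inv hV'inv, mul_sub, sub_mul, mul_one,
    one_mul, sub_right_inj] at hcomm
  have hinv : V⁻¹ = Pᵀ * V'⁻¹ * P := by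
    have h : Pᵀ * Jmat ℚ g * (P * (Jmat ℚ g * V⁻¹)) =
        Pᵀ * Jmat ℚ g * (Jmat ℚ g * V'⁻¹ * P) := by rw [hcomm]
    rw [← mul_assoc, hform, ← mul_assoc, Jmat_mul_self, mul_assoc Pᵀ, mul_assoc (Jmat ℚ g),
      ← mul_assoc (Jmat ℚ g) (Jmat ℚ g), Jmat_mul_self] at h
    simpa [mul_assoc] using h
  have hone : Pᵀ * (V'⁻¹ * P * V) = 1 := by
    rw [← mul_assoc, ← mul_assoc, ← hinv, Matrix.nonsing_inv_mul V hVinv]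
  calc V' = V' * (V'⁻¹ * P * V * Pᵀ) := by rw [mul_eq_one_comm.mp hone, mul_one]
    _ = P * V * Pᵀ := by
      simp only [← mul_assoc, Matrix.mul_nonsing_inv V' hV'inv, one_mul]
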